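/- The Gauss hypergeometric series satisfies ₂F₁(1/10, 3/10; 1/2; 125/128) = (1/6) · 2^{3/10} · 3^{1/10} · (√5 + 3). -/

import Mathlib

open scoped Nat

/-- Pochhammer symbol (rising factorial) on the reals. -/
noncomputable def poch (a : ℝ) (n : ℕ) : ℝ := ∏ i ∈ Finset.range n, (a + i)

/-- Gauss hypergeometric series ₂F₁(a,b;c;x) as a real series. -/
noncomputable def twoFone (a b c x : ℝ) : ℝ :=
  ∑' n : ℕ, poch a n * poch b n / (poch c n * (n ! : ℝ)) * x ^ n

open MeasureTheory Set ProbabilityTheory in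
lemma beta_int (α β : ℝ) (hα : 0 < α) (hβ : 0 < β) :
    IntegrableOn (fun x : ℝ => x ^ (α - 1) * (1 - x) ^ (β - 1)) (Ioo 0 1) ∧
    ∫ x in Ioo (0:ℝ) 1, x ^ (α - 1) * (1 - x) ^ (β - 1) = beta α β := by
  have hB := beta_pos hα hβ
  have h1 := lintegral_betaPDF_eq_one hα hβ
  rw [lintegral_betaPDF] at h1
  have hnn : 0 ≤ᵐ[volume.restrict (Ioo (0:ℝ) 1)]
      (fun x : ℝ => 1 / beta α β * x ^ (α - 1) * (1 - x) ^ (β - 1)) := by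
    refine ae_restrict_of_forall_mem measurableSet_Ioo (fun x hx ↦ ?_)
    have h2 : 0 < 1 - x := by linarith [hx.2]
    have h3 : 0 < x := hx.1
    show 0 ≤ 1 / beta α β * x ^ (α - 1) * (1 - x) ^ (β - 1)
    positivity
  have hi : IntegrableOn (fun x : ℝ => 1 / beta α β * x ^ (α - 1) * (1 - x) ^ (β - 1))
      (Ioo 0 1) := by
    refine ⟨Measurable.aestronglyMeasurable (by fun_prop), ?_⟩
    rw [hasFiniteIntegral_iff_ofReal hnn, h1]
    simp
  have hv : ∫ x in Ioo (0:ℝ) 1, 1 / beta α β * x ^ (α - 1) * (1 - x) ^ (β - 1) = 1 := by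
    rw [integral_eq_lintegral_of_nonneg_ae hnn (Measurable.aestronglyMeasurable (by fun_prop)), h1]
    simp
  have e : ∀ x : ℝ, x ^ (α - 1) * (1 - x) ^ (β - 1)
      = beta α β * (1 / beta α β * x ^ (α - 1) * (1 - x) ^ (β - 1)) := by
    intro x; field_simp
  constructor
  · simp_rw [e]
    exact hi.const_mul _
  · simp_rw [e]
    rw [integral_const_mul, hv, mul_one]

lemma poch_succ (a : ℝ) (n : ℕ) : poch a (n+1) = poch a n * (a + n) := by
  simp [poch, Finset.prod_range_succ]

lemma poch_pos {a : ℝ} (ha : 0 < a) (n : ℕ) : 0 < poch a n :=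
  Finset.prod_pos fun i _ => by positivity

lemma Gamma_poch {a : ℝ} (ha : 0 < a) (n : ℕ) :
    Real.Gamma (a + n) = poch a n * Real.Gamma a := by
  induction n with
  | zero => simp [poch]
  | succ n ih =>
    have : (a + n : ℝ) ≠ 0 := by positivity
    push_cast
    rw [← add_assoc, Real.Gamma_add_one this, ih, poch_succ]; ring

lemma poch_le {a b : ℝ} (ha : 0 < a) (hab : a ≤ b) (n : ℕ) : poch a n ≤ poch b n :=
  Finset.prod_le_prod (fun i _ => by positivity) (fun i _ => by linarith)

lemma poch_one (n : ℕ) : poch 1 n = (n ! : ℝ) := by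
  induction n with
  | zero => simp [poch]
  | succ n ih => rw [poch_succ, ih, Nat.factorial_succ]; push_cast; ring

lemma choose_poch (a : ℝ) (n : ℕ) : Ring.choose (a + n - 1) n = poch a n / (n ! : ℝ) := by
  have h : Ring.choose (a + n - 1) n = Ring.multichoose a n := by
    unfold Ring.choose; congr 1; ring
  rw [h]
  have h2 := Ring.factorial_nsmul_multichoose_eq_ascPochhammer a n
  have h3 : (ascPochhammer ℕ n).smeval a = poch a n := by
    rw [Polynomial.ascPochhammer_smeval_eq_eval]
    induction n with
    | zero => simp [poch]
    | succ n ih =>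
      rw [ascPochhammer_succ_eval, poch_succ]
      rw [ih (by unfold Ring.choose; congr 1; ring)
        (Ring.factorial_nsmul_multichoose_eq_ascPochhammer a n)]
  rw [h3, nsmul_eq_mul] at h2
  rw [← h2]
  have : (n ! : ℝ) ≠ 0 := by positivity
  field_simp

lemma binom_hasSum (a y : ℝ) (h0 : 0 ≤ y) (h1 : y < 1) :
    HasSum (fun n : ℕ => poch a n / (n ! : ℝ) * y ^ n) ((1 - y) ^ (-a)) := by
  have h := (Real.one_div_one_sub_rpow_hasFPowerSeriesOnBall_zero a).hasSum (y := y) (by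
    simp only [Metric.mem_eball, edist_zero_right, enorm_eq_nnnorm]
    rw [show (1:ENNReal) = ((1:NNReal) : ENNReal) by simp, ENNReal.coe_lt_coe,
      ← NNReal.coe_lt_coe]
    simp [abs_of_nonneg h0, h1])
  simp only [zero_add, FormalMultilinearSeries.ofScalars_apply_eq, choose_poch, smul_eq_mul] at h
  rw [Real.rpow_neg (by linarith)]
  simpa using h

open MeasureTheory Set ProbabilityTheory in
lemma euler_int (a b c x : ℝ) (ha : 0 < a) (ha1 : a ≤ 1) (hb : 0 < b) (hbc : b < c)
    (hx : 0 ≤ x) (hx1 : x < 1) :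
    IntegrableOn (fun t : ℝ => t ^ (b - 1) * (1 - t) ^ (c - b - 1) * (1 - x * t) ^ (-a)) (Ioo 0 1) ∧
    ∫ t in Ioo (0:ℝ) 1, t ^ (b - 1) * (1 - t) ^ (c - b - 1) * (1 - x * t) ^ (-a)
      = beta b (c - b) * twoFone a b c x := by
  have hc : 0 < c := hb.trans hbc
  have hcb : 0 < c - b := by linarith
  have hB := beta_pos hb hcb
  constructor
  · have h := ((beta_int b (c-b) hb hcb).1).mul_const ((1 - x) ^ (-a))
    refine Integrable.mono' h (Measurable.aestronglyMeasurable (by fun_prop)) ?_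
    refine ae_restrict_of_forall_mem measurableSet_Ioo (fun t ht ↦ ?_)
    have h2 : 0 < 1 - t := by linarith [ht.2]
    have h3 : 0 < t := ht.1
    have h4 : 1 - x ≤ 1 - x * t := by nlinarith [ht.2]
    have h5 : 0 < 1 - x * t := by linarith
    rw [Real.norm_of_nonneg (by positivity)]
    refine mul_le_mul_of_nonneg_left ?_ (by positivity)
    exact Real.rpow_le_rpow_of_nonpos (by linarith) h4 (by linarith)
  · set F : ℕ → ℝ → ℝ := fun n t =>
      (poch a n / (n ! : ℝ) * x ^ n) * (t ^ (b + n - 1) * (1 - t) ^ (c - b - 1)) with hF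
    have hbn : ∀ n : ℕ, 0 < b + n := fun n => by positivity
    have hFi : ∀ n, Integrable (F n) (volume.restrict (Ioo 0 1)) := fun n =>
      ((beta_int (b + n) (c - b) (hbn n) hcb).1).const_mul _
    have hFv : ∀ n, ∫ t in Ioo (0:ℝ) 1, F n t
        = beta b (c - b) * (poch a n * poch b n / (poch c n * (n ! : ℝ)) * x ^ n) := by
      intro n
      simp only [hF]
      rw [integral_const_mul, (beta_int (b + n) (c - b) (hbn n) hcb).2]
      unfold beta
      rw [show b + n + (c - b) = c + n by ring, show b + (c - b) = c by ring, Gamma_poch hb,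
        Gamma_poch hc]
      have := (Real.Gamma_pos_of_pos hc).ne'
      have := (poch_pos hc n).ne'
      field_simp
    have hFn : ∀ n, ∫ t in Ioo (0:ℝ) 1, ‖F n t‖ = ∫ t in Ioo (0:ℝ) 1, F n t := by
      intro n
      refine setIntegral_congr_fun measurableSet_Ioo fun t ht => ?_
      have h2 : 0 < 1 - t := by linarith [ht.2]
      have h3 : 0 < t := ht.1
      have := poch_pos ha n
      exact Real.norm_of_nonneg (by simp only [hF]; positivity)
    have hs : Summable fun n => ∫ t in Ioo (0:ℝ) 1, ‖F n t‖ := by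
      simp_rw [hFn, hFv]
      refine Summable.mul_left _ ?_
      refine Summable.of_nonneg_of_le (fun n => ?_) (fun n => ?_)
        (summable_geometric_of_lt_one hx hx1)
      · have := poch_pos ha n
        have := poch_pos hb n
        have := poch_pos hc n
        positivity
      · have p1 := poch_pos ha n
        have p2 := poch_pos hb n
        have p3 := poch_pos hc n
        have h4 := poch_le ha ha1 n
        rw [poch_one] at h4
        have h5 := poch_le hb hbc.le n
        have : poch a n * poch b n / (poch c n * (n ! : ℝ)) ≤ 1 := by
          rw [div_le_one (by positivity), mul_comm (poch c n)]
          exact mul_le_mul h4 h5 p2.le (by positivity)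
        exact mul_le_of_le_one_left (by positivity) this
    have key := hasSum_integral_of_summable_integral_norm hFi hs
    have e1 : ∫ t in Ioo (0:ℝ) 1, (∑' n, F n t) =
        ∫ t in Ioo (0:ℝ) 1, t ^ (b - 1) * (1 - t) ^ (c - b - 1) * (1 - x * t) ^ (-a) := by
      refine setIntegral_congr_fun measurableSet_Ioo fun t ht => ?_
      have h2 : 0 < 1 - t := by linarith [ht.2]
      have h3 : 0 < t := ht.1
      have h4 : x * t < 1 := by nlinarith
      have hh := (binom_hasSum a (x * t) (by positivity) h4).mul_left
        (t ^ (b - 1) * (1 - t) ^ (c - b - 1))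
      rw [← hh.tsum_eq]
      refine tsum_congr fun n => ?_
      simp only [hF]
      rw [show b + n - 1 = (b - 1) + n by ring, Real.rpow_add h3, Real.rpow_natCast, mul_pow]
      ring
    rw [← e1, ← key.tsum_eq]
    simp_rw [hFv]
    rw [tsum_mul_left]
    rfl

lemma alg1_exp (t u w d S A B D : ℝ) (ht : 0 < t) (hu : 0 < u) (hw : 0 < w) (hd : 0 < d)
    (hS : 0 < S) (hA : 0 < A) (hB : 0 < B) (hD : 0 < D) :
    t ^ (3/10 - 1 : ℝ) * u ^ (1/2 - 3/10 - 1 : ℝ) * (D ^ 3 / A ^ 7 * w) ^ (-(1/10) : ℝ) =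
    (A ^ (3/10 : ℝ) * B ^ (1/10 : ℝ) / B) * ((B ^ 3 / (A * D) * w ^ 2 * d ^ 4 / S ^ 3) *
      ((B ^ 3 / (A ^ 2 * D) * t * w ^ 3 / S ^ 2) ^ (3/10 - 1 : ℝ) *
        (u * d ^ 5 / S ^ 2) ^ (1/5 - 1 : ℝ))) := by
  rw [← Real.exp_log ht, ← Real.exp_log hu, ← Real.exp_log hw, ← Real.exp_log hd,
    ← Real.exp_log hS, ← Real.exp_log hA, ← Real.exp_log hB, ← Real.exp_log hD]
  simp only [← Real.exp_nat_mul, ← Real.exp_add, ← Real.exp_sub, ← Real.exp_mul]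
  congr 1
  push_cast
  ring

lemma alg2_exp (t u w d S A B D : ℝ) (ht : 0 < t) (hu : 0 < u) (hw : 0 < w) (hd : 0 < d)
    (hS : 0 < S) (hA : 0 < A) (hB : 0 < B) (hD : 0 < D) :
    t ^ (3/10 - 1 : ℝ) * u ^ (1/2 - 3/10 - 1 : ℝ) * (D ^ 3 / A ^ 7 * w) ^ (-(1/10) : ℝ) =
    (A ^ (3/10 : ℝ) * B ^ (1/10 : ℝ) / B) * ((A ^ 3 * D / B ^ 3 * S * d ^ 4 / (t ^ 2 * w ^ 4)) *
      ((A ^ 2 * D / B ^ 3 * u * d ^ 5 / (t * w ^ 3)) ^ (1/5 - 1 : ℝ) *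
        (A ^ 2 * D / B ^ 3 * S ^ 2 / (t * w ^ 3)) ^ (1/2 - 1 : ℝ))) := by
  rw [← Real.exp_log ht, ← Real.exp_log hu, ← Real.exp_log hw, ← Real.exp_log hd,
    ← Real.exp_log hS, ← Real.exp_log hA, ← Real.exp_log hB, ← Real.exp_log hD]
  simp only [← Real.exp_nat_mul, ← Real.exp_add, ← Real.exp_sub, ← Real.exp_mul]
  congr 1
  push_cast
  ring

open MeasureTheory Set in
lemma cov_mono (f f' g E : ℝ → ℝ) (C a b : ℝ) (hab : a < b) (hc : ContinuousOn f (Icc a b))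
    (hd : ∀ t ∈ Ioo a b, HasDerivAt f (f' t) t) (hp : ∀ t ∈ Ioo a b, 0 < f' t)
    (h0 : f a = 0) (h1 : f b = 1) (hE : ∀ t ∈ Ioo a b, E t = C * (f' t * g (f t))) :
    ∫ t in Ioo a b, E t = C * ∫ s in Ioo (0:ℝ) 1, g s := by
  have hm : StrictMonoOn f (Icc a b) := by
    refine strictMonoOn_of_deriv_pos (convex_Icc a b) hc fun t ht => ?_
    rw [interior_Icc] at ht
    rw [(hd t ht).deriv]; exact hp t ht
  have him := ContinuousOn.image_Ioo_of_strictMonoOn hab.le hc hm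
  rw [h0, h1] at him
  rw [← him, integral_image_eq_integral_abs_deriv_smul measurableSet_Ioo
    (fun t ht => (hd t ht).hasDerivWithinAt) (hm.injOn.mono Ioo_subset_Icc_self),
    ← integral_const_mul]
  refine setIntegral_congr_fun measurableSet_Ioo fun t ht => ?_
  simp only [smul_eq_mul]
  rw [hE t ht, abs_of_pos (hp t ht)]

open MeasureTheory Set in
lemma cov_anti (f f' g E : ℝ → ℝ) (C a b : ℝ) (hab : a < b) (hc : ContinuousOn f (Icc a b))
    (hd : ∀ t ∈ Ioo a b, HasDerivAt f (f' t) t) (hp : ∀ t ∈ Ioo a b, f' t < 0)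
    (h0 : f a = 1) (h1 : f b = 0) (hE : ∀ t ∈ Ioo a b, E t = C * (-f' t * g (f t))) :
    ∫ t in Ioo a b, E t = C * ∫ s in Ioo (0:ℝ) 1, g s := by
  have hm : StrictAntiOn f (Icc a b) := by
    refine strictAntiOn_of_deriv_neg (convex_Icc a b) hc fun t ht => ?_
    rw [interior_Icc] at ht
    rw [(hd t ht).deriv]; exact hp t ht
  have him := ContinuousOn.image_Ioo_of_strictAntiOn hab.le hc hm
  rw [h0, h1] at him
  rw [← him, integral_image_eq_integral_abs_deriv_smul measurableSet_Ioo
    (fun t ht => (hd t ht).hasDerivWithinAt) (hm.injOn.mono Ioo_subset_Icc_self),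
    ← integral_const_mul]
  refine setIntegral_congr_fun measurableSet_Ioo fun t ht => ?_
  simp only [smul_eq_mul]
  rw [hE t ht, abs_of_neg (hp t ht)]

/-- The cubic whose square is the numerator of `1 - R`. -/
noncomputable def Scub (t : ℝ) : ℝ := t ^ 3 - 21/10 * t ^ 2 + 96/125 * t + 1024/3125

/-- The Euler integrand. -/
noncomputable def Eul (t : ℝ) : ℝ :=
  t ^ (3/10 - 1 : ℝ) * (1 - t) ^ (1/2 - 3/10 - 1 : ℝ) * (1 - 125/128 * t) ^ (-(1/10) : ℝ)

/-- The algebraic constant. -/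
noncomputable def Cst : ℝ := (2:ℝ) ^ (3/10 : ℝ) * (3:ℝ) ^ (1/10 : ℝ) / 3

lemma Scub_sq (t : ℝ) :
    Scub t ^ 2 = 27/20 * t * (128/125 - t) ^ 3 + (1 - t) * (16/25 - t) ^ 5 := by
  unfold Scub; ring

lemma Scub_deriv (t : ℝ) : HasDerivAt Scub (3 * t ^ 2 - 21/5 * t + 96/125) t := by
  unfold Scub
  have h := ((((hasDerivAt_id t).pow 3).sub (((hasDerivAt_id t).pow 2).const_mul (21/10))).add
    ((hasDerivAt_id t).const_mul (96/125))).add_const (1024/3125 : ℝ)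
  refine h.congr_deriv ?_
  simp; ring

lemma Scub_pos (t : ℝ) (h0 : 0 ≤ t) (h1 : t ≤ 16/25) : 0 < Scub t := by
  unfold Scub
  nlinarith [mul_nonneg h0 (sub_nonneg.2 h1), mul_nonneg (mul_nonneg h0 h0) (sub_nonneg.2 h1),
    mul_nonneg h0 (mul_nonneg (sub_nonneg.2 h1) (sub_nonneg.2 h1))]

open MeasureTheory Set in
lemma int_left : ∫ t in Ioo (0:ℝ) (16/25), Eul t
    = Cst * ∫ s in Ioo (0:ℝ) 1, s ^ (3/10 - 1 : ℝ) * (1 - s) ^ (1/5 - 1 : ℝ) := by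
  have hne : ∀ t ∈ Icc (0:ℝ) (16/25), Scub t ^ 2 ≠ 0 := fun t ht =>
    (pow_pos (Scub_pos t ht.1 ht.2) 2).ne'
  refine cov_mono (fun t => 27/20 * t * (128/125 - t) ^ 3 / Scub t ^ 2)
    (fun t => 27/10 * (128/125 - t) ^ 2 * (16/25 - t) ^ 4 / Scub t ^ 3)
    (fun s => s ^ (3/10 - 1 : ℝ) * (1 - s) ^ (1/5 - 1 : ℝ)) Eul Cst 0 (16/25)
    (by norm_num) ?_ ?_ ?_ ?_ ?_ ?_
  · refine ContinuousOn.div (by fun_prop) ?_ hne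
    unfold Scub; fun_prop
  · intro t ht
    have hS := (Scub_pos t ht.1.le ht.2.le).ne'
    have h := ((((hasDerivAt_id t).const_mul (27/20)).mul
      (((hasDerivAt_id t).const_sub (128/125)).pow 3)).div ((Scub_deriv t).pow 2)
      (pow_ne_zero 2 hS))
    refine h.congr_deriv ?_
    simp
    field_simp
    unfold Scub
    ring
  · intro t ht
    have hS := (Scub_pos t ht.1.le ht.2.le)
    have h1 : 0 < 128/125 - t := by linarith [ht.2]
    have h2 : 0 < 16/25 - t := by linarith [ht.2]
    positivity
  · simp
  · simp only [Scub]; norm_num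
  · intro t ht
    have hS := (Scub_pos t ht.1.le ht.2.le)
    have h1 : 0 < 128/125 - t := by linarith [ht.2]
    have h2 : 0 < 16/25 - t := by linarith [ht.2]
    have h3 : 0 < 1 - t := by linarith [ht.2]
    have h := alg1_exp t (1 - t) (128/125 - t) (16/25 - t) (Scub t) 2 3 5 ht.1 h3 h1 h2 hS
      (by norm_num) (by norm_num) (by norm_num)
    have e1 : 1 - 27/20 * t * (128/125 - t) ^ 3 / Scub t ^ 2
        = (1 - t) * (16/25 - t) ^ 5 / Scub t ^ 2 := by
      rw [eq_div_iff (by positivity), sub_mul, div_mul_cancel₀ _ (by positivity), Scub_sq]; ring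
    simp only [Eul, Cst]
    rw [e1]
    convert h using 3 <;> first | ring | norm_num

open Set in
lemma fR_cont (a b : ℝ) (ha : 0 < a) (hb : b ≤ 1) : ContinuousOn (fun t : ℝ =>
    (1 - t) * (t - 16/25) ^ 5 / (27/20 * t * (128/125 - t) ^ 3)) (Icc a b) := by
  refine ContinuousOn.div (by fun_prop) (by fun_prop) ?_
  intro t ht
  have h1 : 0 < 128/125 - t := by linarith [ht.2]
  have h2 : 0 < t := by linarith [ht.1]
  positivity

lemma fR_deriv (t : ℝ) (h0 : 0 < t) (h1 : t < 1) : HasDerivAt (fun t : ℝ =>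
    (1 - t) * (t - 16/25) ^ 5 / (27/20 * t * (128/125 - t) ^ 3))
    (40/27 * Scub t * (t - 16/25) ^ 4 / (t ^ 2 * (128/125 - t) ^ 4)) t := by
  have h2 : 0 < 128/125 - t := by linarith
  have h := ((((hasDerivAt_id t).const_sub 1).mul
      (((hasDerivAt_id t).sub_const (16/25)).pow 5)).div (((hasDerivAt_id t).const_mul (27/20)).mul
      (((hasDerivAt_id t).const_sub (128/125)).pow 3))) (by simp only [id, Pi.mul_apply, Pi.pow_apply]; positivity)
  refine h.congr_deriv ?_
  simp
  have := h2.ne'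
  field_simp
  unfold Scub
  ring

lemma fR_E (t S : ℝ) (h0 : 16/25 < t) (h1 : t < 1) (hS : 0 < S) (hS2 : S ^ 2 = Scub t ^ 2) :
    Eul t = Cst * ((40/27 * S * (t - 16/25) ^ 4 / (t ^ 2 * (128/125 - t) ^ 4)) *
      (((1 - t) * (t - 16/25) ^ 5 / (27/20 * t * (128/125 - t) ^ 3)) ^ (1/5 - 1 : ℝ) *
      (1 - (1 - t) * (t - 16/25) ^ 5 / (27/20 * t * (128/125 - t) ^ 3)) ^ (1/2 - 1 : ℝ))) := by
  have ht : 0 < t := by linarith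
  have h2 : 0 < 128/125 - t := by linarith
  have h3 : 0 < t - 16/25 := by linarith
  have h4 : 0 < 1 - t := by linarith
  have h := alg2_exp t (1 - t) (128/125 - t) (t - 16/25) S 2 3 5 ht h4 h2 h3 hS
      (by norm_num) (by norm_num) (by norm_num)
  have e1 : 1 - (1 - t) * (t - 16/25) ^ 5 / (27/20 * t * (128/125 - t) ^ 3)
      = 2 ^ 2 * 5 / 3 ^ 3 * S ^ 2 / (t * (128/125 - t) ^ 3) := by
    have aux : ∀ X Y Z : ℝ, X ≠ 0 → Z = 27/20 * X - Y →
        1 - Y / (27/20 * X) = 2 ^ 2 * 5 / 3 ^ 3 * Z / X := by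
      intro X Y Z hX hZ
      subst hZ
      field_simp
      ring
    rw [mul_assoc (27/20) t]
    refine aux _ _ _ (by positivity) ?_
    rw [hS2, Scub_sq]
    ring
  have e2 : (1 - t) * (t - 16/25) ^ 5 / (27/20 * t * (128/125 - t) ^ 3)
      = 2 ^ 2 * 5 / 3 ^ 3 * (1 - t) * (t - 16/25) ^ 5 / (t * (128/125 - t) ^ 3) := by
    have := h2.ne'
    field_simp
    ring
  rw [e1, e2]
  simp only [Eul, Cst]
  convert h using 3 <;> first | ring | norm_num

open Set in
lemma Scub_root : ∃ r ∈ Ioo (16/25 : ℝ) 1, Scub r = 0 ∧ (∀ t ∈ Ioo (16/25) r, 0 < Scub t) ∧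
    ∀ t ∈ Ioo r 1, Scub t < 0 := by
  have hc : ContinuousOn Scub (Icc (16/25) 1) := by unfold Scub; fun_prop
  have hm : StrictAntiOn Scub (Icc (16/25) 1) := by
    refine strictAntiOn_of_deriv_neg (convex_Icc _ _) hc fun t ht => ?_
    rw [interior_Icc] at ht
    rw [(Scub_deriv t).deriv]
    nlinarith [ht.1, ht.2, mul_pos (sub_pos.2 ht.1) (sub_pos.2 ht.2)]
  have h := intermediate_value_Ioo' (by norm_num : (16/25:ℝ) ≤ 1) hc
  obtain ⟨r, hr, hr0⟩ := h (show (0:ℝ) ∈ Ioo (Scub 1) (Scub (16/25)) by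
    unfold Scub; constructor <;> norm_num)
  refine ⟨r, hr, hr0, fun t ht => ?_, fun t ht => ?_⟩
  · rw [← hr0]; exact hm ⟨ht.1.le, (ht.2.trans hr.2).le⟩ ⟨hr.1.le, hr.2.le⟩ ht.2
  · rw [← hr0]; exact hm ⟨hr.1.le, hr.2.le⟩ ⟨(hr.1.trans ht.1).le, ht.2.le⟩ ht.1

lemma fR_root (r : ℝ) (h0 : 0 < r) (h1 : r < 1) (hr : Scub r = 0) :
    (1 - r) * (r - 16/25) ^ 5 / (27/20 * r * (128/125 - r) ^ 3) = 1 := by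
  have h2 : 0 < 128/125 - r := by linarith
  rw [div_eq_one_iff_eq (by positivity)]
  have h := Scub_sq r
  rw [hr] at h
  linarith

open MeasureTheory Set in
lemma Ioo_split (a b c : ℝ) (hab : a < b) (hbc : b < c) (f : ℝ → ℝ) (hf : IntegrableOn f (Ioo a c)) :
    ∫ t in Ioo a c, f t = (∫ t in Ioo a b, f t) + ∫ t in Ioo b c, f t := by
  rw [← integral_Ioc_eq_integral_Ioo (x := a) (y := b), ← setIntegral_union _ measurableSet_Ioo
    (hf.mono_set (Ioc_subset_Ioo_right hbc)) (hf.mono_set (Ioo_subset_Ioo_left hab.le)),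
    Ioc_union_Ioo_eq_Ioo hab.le hbc]
  rw [Set.disjoint_left]
  intro x hx hy
  exact absurd hx.2 (not_le.2 hy.1)

open MeasureTheory Set ProbabilityTheory in
lemma int_total (hi : IntegrableOn Eul (Ioo 0 1)) : ∫ t in Ioo (0:ℝ) 1, Eul t
    = Cst * (beta (3/10) (1/5) + 2 * beta (1/5) (1/2)) := by
  obtain ⟨r, hr, hr0, hpos, hneg⟩ := Scub_root
  have hr' : 0 < r := by linarith [hr.1]
  have e2 := (beta_int (1/5) (1/2) (by norm_num) (by norm_num)).2
  have i1 := int_left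
  rw [(beta_int (3/10) (1/5) (by norm_num) (by norm_num)).2] at i1
  have i2 : ∫ t in Ioo (16/25) r, Eul t
      = Cst * ∫ s in Ioo (0:ℝ) 1, s ^ (1/5 - 1 : ℝ) * (1 - s) ^ (1/2 - 1 : ℝ) := by
    refine cov_mono _ _ (fun s => s ^ (1/5 - 1 : ℝ) * (1 - s) ^ (1/2 - 1 : ℝ)) Eul Cst (16/25) r
      hr.1 (fR_cont _ _ (by norm_num) hr.2.le)
      (fun t ht => fR_deriv t (by linarith [ht.1]) (ht.2.trans hr.2)) ?_ (by simp)
      (fR_root r hr' hr.2 hr0)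
      (fun t ht => fR_E t (Scub t) ht.1 (ht.2.trans hr.2) (hpos t ht) rfl)
    intro t ht
    have := hpos t ht
    have h1 : 0 < t - 16/25 := by linarith [ht.1]
    have h2 : 0 < t := by linarith
    have h3 : 0 < 128/125 - t := by linarith [ht.2, hr.2]
    positivity
  have i3 : ∫ t in Ioo r 1, Eul t
      = Cst * ∫ s in Ioo (0:ℝ) 1, s ^ (1/5 - 1 : ℝ) * (1 - s) ^ (1/2 - 1 : ℝ) := by
    refine cov_anti _ _ (fun s => s ^ (1/5 - 1 : ℝ) * (1 - s) ^ (1/2 - 1 : ℝ)) Eul Cst r 1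
      hr.2 (fR_cont _ _ hr' le_rfl)
      (fun t ht => fR_deriv t (by linarith [ht.1]) ht.2) ?_ (fR_root r hr' hr.2 hr0) (by simp) ?_
    · intro t ht
      have := hneg t ht
      have h1 : 0 < t - 16/25 := by linarith [ht.1, hr.1]
      have h2 : 0 < t := by linarith
      have h3 : 0 < 128/125 - t := by linarith [ht.2]
      refine div_neg_of_neg_of_pos (mul_neg_of_neg_of_pos (by linarith) (by positivity))
        (by positivity)
    · intro t ht
      rw [fR_E t (-Scub t) (hr.1.trans ht.1) ht.2 (by linarith [hneg t ht]) (by ring)]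
      ring
  rw [Ioo_split 0 (16/25) 1 (by norm_num) (by norm_num) _ hi,
    Ioo_split (16/25) r 1 hr.1 hr.2 _ (hi.mono_set (Ioo_subset_Ioo_left (by norm_num))),
    i1, i2, i3, e2]
  ring

open ProbabilityTheory in
lemma beta_ratio : beta (1/5) (1/2) = beta (3/10) (1/5) * ((1 + √5) / 4) := by
  have h1 := Real.Gamma_mul_Gamma_one_sub (3/10)
  have h2 := Real.Gamma_one_half_eq
  have hs : Real.sin (Real.pi * (3/10)) = (1 + √5) / 4 := by
    rw [← Real.cos_pi_div_five, ← Real.cos_pi_div_two_sub]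
    congr 1; ring
  rw [hs, show (1 - 3/10 : ℝ) = 7/10 by norm_num] at h1
  unfold beta
  rw [show (1/5 + 1/2 : ℝ) = 7/10 by norm_num, show (3/10 + 1/5 : ℝ) = 1/2 by norm_num]
  have g1 := (Real.Gamma_pos_of_pos (show (0:ℝ) < 7/10 by norm_num)).ne'
  have g2 := (Real.Gamma_pos_of_pos (show (0:ℝ) < 1/2 by norm_num)).ne'
  have h3 : Real.Gamma (1/2) * Real.Gamma (1/2) = Real.pi := by
    rw [h2]; exact Real.mul_self_sqrt Real.pi_pos.le
  have h5 : (1 + √5) / 4 ≠ 0 := by positivity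
  rw [eq_div_iff h5] at h1
  rw [div_mul_eq_mul_div, div_eq_div_iff g1 g2]
  linear_combination Real.Gamma (1/5) * (h3 - h1)

theorem stmt2 : twoFone (1/10) (3/10) (1/2) (125/128) = (1/6) * (2:ℝ) ^ ((3:ℝ)/10) * (3:ℝ) ^ ((1:ℝ)/10) * (Real.sqrt 5 + 3) := by
  obtain ⟨hi, hv⟩ := euler_int (1/10) (3/10) (1/2) (125/128) (by norm_num) (by norm_num)
    (by norm_num) (by norm_num) (by norm_num) (by norm_num)
  have ht := int_total hi
  have hB := ProbabilityTheory.beta_pos (show (0:ℝ) < 3/10 by norm_num)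
    (show (0:ℝ) < 1/5 by norm_num)
  unfold Eul at ht
  rw [hv, beta_ratio, show (1/2 - 3/10 : ℝ) = 1/5 by norm_num] at ht
  refine mul_left_cancel₀ hB.ne' (ht.trans ?_)
  unfold Cst
  ring
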